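/- arXiv:1904.12705 — 5 statements merged into one kernel-verified Lean document; each statement's English description precedes it below -/
import Mathlib

section
/- Fix μ ∈ (0,1/2] and n ≥ 3. Let η : ℤ/nℤ → S be a configuration on the ring R_n and let η' be obtained from η by a μ-compromise at some edge ⟨w,w+1⟩ of R_n. Then the total disagreement around the ring does not increase: ∑_{v ∈ ℤ/nℤ} ‖η'(v+1) − η'(v)‖ ≤ ∑_{v ∈ ℤ/nℤ} ‖η(v+1) − η(v)‖. -/
open Filter Topology
open scoped BigOperators

noncomputable section

instance : Fact ((0:ℝ) < 2) := ⟨by norm_num⟩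

/-- The circle opinion space `S = ℝ/2ℤ`. -/
abbrev S := AddCircle (2 : ℝ)

/-- `(x', y')` is a `μ`-compromise of `(x, y)`. -/
def IsCompromise (μ : ℝ) (x y x' y' : S) : Prop :=
  ∃ a b : ℝ, (a : S) = x ∧ (b : S) = y ∧ |a - b| ≤ 1 ∧
    x' = ((a + μ * (b - a) : ℝ) : S) ∧ y' = ((b + μ * (a - b) : ℝ) : S)

/-- `η'` is obtained from `η` by a `μ`-compromise at the edge `⟨w, w+1⟩` of the ring
`R_n` with vertex set `ℤ/nℤ`. -/
def RingUpdateAt (μ : ℝ) {n : ℕ} (w : ZMod n) (η η' : ZMod n → S) : Prop :=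
  IsCompromise μ (η w) (η (w+1)) (η' w) (η' (w+1)) ∧
    ∀ u, u ≠ w → u ≠ w + 1 → η' u = η u

namespace AddCircle

/-- The norm on `ℝ/pℤ` is bounded by the absolute value of any representative. -/
theorem norm_coe_le_abs (p x : ℝ) : ‖(x : AddCircle p)‖ ≤ |x| :=
  QuotientAddGroup.norm_mk_le_norm

end AddCircle

namespace IsCompromise

/-- Some `c ≥ 0` bounds the displacement of both opinions, while their distance shrinks by
`2 * c`. -/
theorem exists_displacement {μ : ℝ} (hμ : μ ∈ Set.Ioc (0 : ℝ) (1 / 2)) {x y x' y' : S}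
    (h : IsCompromise μ x y x' y') :
    ∃ c : ℝ, ‖x' - x‖ ≤ c ∧ ‖y' - y‖ ≤ c ∧ ‖y' - x'‖ ≤ ‖y - x‖ - 2 * c := by
  obtain ⟨a, b, rfl, rfl, hab, rfl, rfl⟩ := h
  have hdist : ‖((b - a : ℝ) : S)‖ = |b - a| := by
    rw [AddCircle.norm_coe_eq_abs_iff 2 two_ne_zero, abs_sub_comm]
    simpa using hab
  simp only [← AddCircle.coe_sub, hdist]
  refine ⟨μ * |b - a|, ?_, ?_, ?_⟩ <;> refine (AddCircle.norm_coe_le_abs 2 _).trans_eq ?_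
  · rw [add_sub_cancel_left, abs_mul, abs_of_pos hμ.1]
  · rw [add_sub_cancel_left, abs_mul, abs_of_pos hμ.1, abs_sub_comm]
  · rw [show b + μ * (a - b) - (a + μ * (b - a)) = (1 - 2 * μ) * (b - a) by ring, abs_mul,
      abs_of_nonneg (by linarith [hμ.2])]
    ring

end IsCompromise

/-- A `μ`-compromise at an edge of the ring `R_n` does not increase the total
disagreement around the ring. -/
theorem ring_total_disagreement_nonincreasing (μ : ℝ) (hμ : μ ∈ Set.Ioc (0:ℝ) (1/2))
    (n : ℕ) [NeZero n] (hn : 3 ≤ n) (w : ZMod n) (η η' : ZMod n → S)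
    (h : RingUpdateAt μ w η η') :
    ∑ v : ZMod n, ‖η' (v+1) - η' v‖ ≤ ∑ v : ZMod n, ‖η (v+1) - η v‖ := by
  obtain ⟨hc, hfix⟩ := h
  obtain ⟨c, hx, hy, hxy⟩ := hc.exists_displacement hμ
  have one_ne : (1 : ZMod n) ≠ 0 := by
    have : Fact (1 < n) := ⟨by omega⟩
    exact one_ne_zero
  have two_ne : (2 : ZMod n) ≠ 0 := by
    intro h
    have : n ∣ 2 := (ZMod.natCast_eq_zero_iff 2 n).1 (by exact_mod_cast h)
    exact absurd (Nat.le_of_dvd two_pos this) (by omega)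
  have hle : ∀ v, ‖η' (v+1) - η' v‖ ≤ ‖η (v+1) - η v‖ +
      ((if v = w - 1 then c else 0) + (if v = w + 1 then c else 0) +
        (if v = w then -(2 * c) else 0)) := by
    intro v
    by_cases hw : v = w
    · subst hw
      have h₁ : v ≠ v - 1 := fun h => one_ne (by linear_combination h)
      have h₂ : v ≠ v + 1 := fun h => one_ne (by linear_combination -h)
      simp only [h₁, h₂, if_true, if_false]
      linarith
    by_cases hl : v = w - 1
    · have h₂ : v ≠ w + 1 := fun h => two_ne (by linear_combination hl - h)
      have hv : v + 1 = w := by rw [hl, sub_add_cancel]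
      rw [hv, hfix v hw h₂, if_pos hl, if_neg h₂, if_neg hw]
      have := norm_sub_le_norm_sub_add_norm_sub (η' w) (η w) (η v)
      linarith
    by_cases hr : v = w + 1
    · have h₁ : v + 1 ≠ w := fun h => hl (eq_sub_of_add_eq h)
      have h₂ : v + 1 ≠ w + 1 := fun h => hw (add_right_cancel h)
      rw [hfix (v + 1) h₁ h₂, if_neg hl, if_pos hr, if_neg hw]
      have := norm_sub_le_norm_sub_add_norm_sub (η (v + 1)) (η v) (η' v)
      rw [← hr, norm_sub_rev] at hy
      linarith
    · have h₁ : v + 1 ≠ w := fun h => hl (eq_sub_of_add_eq h)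
      have h₂ : v + 1 ≠ w + 1 := fun h => hw (add_right_cancel h)
      simp [hfix (v + 1) h₁ h₂, hfix v hw hr, hw, hl, hr]
  calc ∑ v, ‖η' (v+1) - η' v‖ ≤ _ := Finset.sum_le_sum fun v _ => hle v
    _ = ∑ v, ‖η (v+1) - η v‖ := by
      simp only [Finset.sum_add_distrib, Finset.sum_ite_eq', Finset.mem_univ, if_true]
      ring
end
end

section
/- (Strong consensus on finite paths.) Fix μ ∈ (0,1/2] and n ≥ 2. Let (v_k)_{k∈ℕ} be a sequence of edge indices in {1,…,n−1} in which every index occurs infinitely often, and let (η_k)_{k∈ℕ} be configurations η_k : {1,…,n} → S such that for each k, η_{k+1} is obtained from η_k by a μ-compromise at the edge e_{v_k} = ⟨v_k, v_k+1⟩. Then there exists a single limit opinion L ∈ S such that η_k(v) → L as k → ∞ for every vertex v ∈ {1,…,n}, irrespective of the initial configuration η_0. -/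
open Filter Topology MeasureTheory
open scoped BigOperators

noncomputable section

/-- `η'` is obtained from `η` by a `μ`-compromise at the edge `e_v = ⟨v, v+1⟩` of the
path `P_n` with vertex set `{1, …, n}` (so `1 ≤ v ≤ n - 1`). -/
def UpdateAt (μ : ℝ) (n v : ℕ) (η η' : ℕ → S) : Prop :=
  1 ≤ v ∧ v + 1 ≤ n ∧ IsCompromise μ (η v) (η (v+1)) (η' v) (η' (v+1)) ∧
    ∀ u, u ≠ v → u ≠ v + 1 → η' u = η u

theorem norm_coe_le_abs (x : ℝ) : ‖(x : S)‖ ≤ |x| :=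
  QuotientAddGroup.norm_mk_le_norm

/-- A compromise contracts the distance by `1 - 2μ`, and each opinion moves by at most
`μ` times that distance. -/
theorem IsCompromise.norm_le {μ : ℝ} (hμ : μ ∈ Set.Ioc (0:ℝ) (1/2)) {x y x' y' : S}
    (h : IsCompromise μ x y x' y') :
    ‖y' - x'‖ ≤ (1 - 2 * μ) * ‖y - x‖ ∧ ‖x' - x‖ ≤ μ * ‖y - x‖ ∧ ‖y' - y‖ ≤ μ * ‖y - x‖ := by
  obtain ⟨a, b, rfl, rfl, hab, rfl, rfl⟩ := h
  obtain ⟨hμ0, hμ1⟩ := hμ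
  have hd : ‖(b : S) - (a : S)‖ = |b - a| := by
    rw [← AddCircle.coe_sub, AddCircle.norm_coe_eq_abs_iff _ two_ne_zero, abs_sub_comm]
    simpa using hab
  rw [hd]
  simp only [← AddCircle.coe_sub]
  refine ⟨(norm_coe_le_abs _).trans_eq ?_, (norm_coe_le_abs _).trans_eq ?_,
    (norm_coe_le_abs _).trans_eq ?_⟩
  · rw [show b + μ * (a - b) - (a + μ * (b - a)) = (1 - 2 * μ) * (b - a) by ring, abs_mul,
      abs_of_nonneg (show 0 ≤ 1 - 2 * μ by linarith)]
  · rw [add_sub_cancel_left, abs_mul, abs_of_pos hμ0]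
  · rw [add_sub_cancel_left, abs_mul, abs_of_pos hμ0, abs_sub_comm]

theorem UpdateAt.norm_sub_le {μ : ℝ} (hμ : μ ∈ Set.Ioc (0:ℝ) (1/2)) {n v : ℕ} {η η' : ℕ → S}
    (h : UpdateAt μ n v η η') (w : ℕ) : ‖η' w - η w‖ ≤ μ * ‖η (v + 1) - η v‖ := by
  obtain ⟨-, -, hc, hu⟩ := h
  obtain ⟨-, h1, h2⟩ := hc.norm_le hμ
  by_cases hw : w = v
  · exact hw ▸ h1
  by_cases hw' : w = v + 1
  · exact hw' ▸ h2
  rw [hu w hw hw', sub_self, norm_zero]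
  exact mul_nonneg hμ.1.le (norm_nonneg _)

theorem UpdateAt.edge_norm_le {μ : ℝ} (hμ : μ ∈ Set.Ioc (0:ℝ) (1/2)) {n v : ℕ} {η η' : ℕ → S}
    (h : UpdateAt μ n (v + 1) η η') (w : ℕ) :
    ‖η' (w + 1) - η' w‖ ≤ ‖η (w + 1) - η w‖ + μ * ‖η (v + 2) - η (v + 1)‖ *
      ((if w = v then 1 else 0) + (if w = v + 2 then 1 else 0)
        - 2 * (if w = v + 1 then 1 else 0)) := by
  have hmove := h.norm_sub_le hμ
  obtain ⟨-, -, hc, hu⟩ := h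
  have h0 := (hc.norm_le hμ).1
  by_cases hw1 : w = v + 1
  · subst hw1
    simp only [Nat.add_eq_left, one_ne_zero, if_false, if_true, Nat.add_right_inj,
      OfNat.one_ne_ofNat]
    linarith
  by_cases hw : w = v
  · subst hw
    have ht := hmove (w + 1)
    have h3 := norm_add_le (η' (w + 1) - η (w + 1)) (η (w + 1) - η w)
    rw [sub_add_sub_cancel] at h3
    rw [hu w (by lia) (by lia)]
    simp only [if_true, Nat.left_eq_add, OfNat.ofNat_ne_zero, one_ne_zero, if_false]
    linarith
  by_cases hw2 : w = v + 2
  · subst hw2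
    have ht := hmove (v + 2)
    have h3 := norm_add_le (η (v + 2 + 1) - η (v + 2)) (η (v + 2) - η' (v + 2))
    rw [sub_add_sub_cancel, norm_sub_rev (η (v + 2)) (η' (v + 2))] at h3
    rw [hu (v + 2 + 1) (by lia) (by lia)]
    simp only [if_true, hw, hw1, if_false]
    linarith
  · rw [hu w (by lia) (by lia), hu (w + 1) (by lia) (by lia)]
    simp [hw, hw1, hw2]

/-- The edge discrepancies weighted by the concave profile `w (n - w)`, which vanishes at
both ends of the path. -/
def edgeEnergy (n : ℕ) (η : ℕ → S) : ℝ :=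
  ∑ w ∈ Finset.range (n + 1), (w * (n - w) : ℝ) * ‖η (w + 1) - η w‖

theorem edgeEnergy_nonneg (n : ℕ) (η : ℕ → S) : 0 ≤ edgeEnergy n η := by
  refine Finset.sum_nonneg fun w hw => mul_nonneg (mul_nonneg w.cast_nonneg ?_) (norm_nonneg _)
  rw [sub_nonneg, Nat.cast_le]
  exact Finset.mem_range_succ_iff.mp hw

theorem UpdateAt.edgeEnergy_le {μ : ℝ} (hμ : μ ∈ Set.Ioc (0:ℝ) (1/2)) {n v : ℕ} {η η' : ℕ → S}
    (h : UpdateAt μ n v η η') :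
    2 * μ * ‖η (v + 1) - η v‖ + edgeEnergy n η' ≤ edgeEnergy n η := by
  have hv := h.1
  have hvn := h.2.1
  obtain ⟨v, rfl⟩ := Nat.exists_eq_add_of_le' hv
  have key : edgeEnergy n η' ≤ ∑ w ∈ Finset.range (n + 1), (w * (n - w) : ℝ) *
      (‖η (w + 1) - η w‖ + μ * ‖η (v + 2) - η (v + 1)‖ *
      ((if w = v then 1 else 0) + (if w = v + 2 then 1 else 0)
        - 2 * (if w = v + 1 then 1 else 0))) := by
    refine Finset.sum_le_sum fun w hw => mul_le_mul_of_nonneg_left (h.edge_norm_le hμ w) ?_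
    refine mul_nonneg w.cast_nonneg ?_
    rw [sub_nonneg, Nat.cast_le]
    exact Finset.mem_range_succ_iff.mp hw
  have hsum : ∀ u ≤ n, ∑ w ∈ Finset.range (n + 1), (w * (n - w) : ℝ) * (if w = u then 1 else 0)
      = u * (n - u) := by
    intro u hu
    simp [hu]
  have hsplit : ∀ (w : ℕ) (d x y z : ℝ), (w * (n - w) : ℝ) *
      (d + μ * ‖η (v + 2) - η (v + 1)‖ * (x + y - 2 * z)) = (w * (n - w) : ℝ) * d +
      μ * ‖η (v + 2) - η (v + 1)‖ *
        ((w * (n - w) : ℝ) * x + (w * (n - w) : ℝ) * y - 2 * ((w * (n - w) : ℝ) * z)) := by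
    intros; ring
  simp only [hsplit] at key
  rw [Finset.sum_add_distrib, ← Finset.mul_sum, Finset.sum_sub_distrib, Finset.sum_add_distrib,
    ← Finset.mul_sum, hsum v (by lia), hsum (v + 2) (by lia), hsum (v + 1) (by lia)] at key
  push_cast at key
  change 2 * μ * ‖η (v + 2) - η (v + 1)‖ + _ ≤ edgeEnergy n η
  refine (add_le_add_right key _).trans_eq ?_
  rw [edgeEnergy]
  ring

/-- Strong consensus on finite paths: if every edge of the path `P_n` is updated
infinitely often by `μ`-compromises, then all opinions converge to a single common
limit `L ∈ S`, irrespective of the initial configuration. -/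
theorem strong_consensus_on_path (μ : ℝ) (hμ : μ ∈ Set.Ioc (0:ℝ) (1/2)) (n : ℕ)
    (hn : 2 ≤ n) (v : ℕ → ℕ)
    (hio : ∀ w ∈ Finset.Icc 1 (n-1), ∀ K : ℕ, ∃ k, K ≤ k ∧ v k = w)
    (η : ℕ → ℕ → S) (hupd : ∀ k, UpdateAt μ n (v k) (η k) (η (k+1))) :
    ∃ L : S, ∀ w ∈ Finset.Icc 1 n, Tendsto (fun k => η k w) atTop (𝓝 L) := by
  have hsum : Summable fun k => μ * ‖η k (v k + 1) - η k (v k)‖ := by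
    refine summable_of_sum_range_le (c := edgeEnergy n (η 0) / 2)
      (fun k => mul_nonneg hμ.1.le (norm_nonneg _)) fun N => ?_
    suffices h : 2 * ∑ k ∈ Finset.range N, μ * ‖η k (v k + 1) - η k (v k)‖
        + edgeEnergy n (η N) ≤ edgeEnergy n (η 0) by
      linarith [edgeEnergy_nonneg n (η N)]
    induction N with
    | zero => simp
    | succ N ih =>
      rw [Finset.sum_range_succ]
      linarith [(hupd N).edgeEnergy_le hμ]
  have hlim : ∀ w, ∃ L, Tendsto (fun k => η k w) atTop (𝓝 L) := fun w =>
    cauchySeq_tendsto_of_complete <| cauchySeq_of_dist_le_of_summable _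
      (fun k => by rw [dist_eq_norm, norm_sub_rev]; exact (hupd k).norm_sub_le hμ w) hsum
  choose L hL using hlim
  have hstep : ∀ w ∈ Finset.Icc 1 (n - 1), L (w + 1) = L w := by
    intro w hw
    have hdist : Tendsto (fun k => μ * ‖η k (w + 1) - η k w‖) atTop
        (𝓝 (μ * ‖L (w + 1) - L w‖)) := (((hL (w + 1)).sub (hL w)).norm).const_mul μ
    have hfreq : ∃ᶠ k in atTop, v k = w :=
      frequently_atTop.mpr fun K => hio w hw K
    have hzero : μ * ‖L (w + 1) - L w‖ = 0 := by
      obtain ⟨φ, hφ, hφw⟩ := extraction_of_frequently_atTop hfreq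
      refine tendsto_nhds_unique (hdist.comp hφ.tendsto_atTop) ?_
      refine (hsum.tendsto_atTop_zero.comp hφ.tendsto_atTop).congr fun k => ?_
      simp only [Function.comp_apply, hφw k]
    exact sub_eq_zero.mp (norm_eq_zero.mp ((mul_eq_zero.mp hzero).resolve_left hμ.1.ne'))
  refine ⟨L 1, fun w hw => ?_⟩
  obtain ⟨hw1, hwn⟩ := Finset.mem_Icc.mp hw
  suffices h : L w = L 1 from h ▸ hL w
  clear hw
  induction w, hw1 using Nat.le_induction with
  | base => rfl
  | succ w hw ih => rw [hstep w (Finset.mem_Icc.mpr ⟨hw, by lia⟩), ih (by lia)]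
end
end

section
/- (Convergence of the unwrapped edge-difference process on a path.) Fix μ ∈ (0,1/2] and n ≥ 2. Let (v_k)_{k∈ℕ} be a sequence of edge indices in {1,…,n−1} in which every index occurs infinitely often, and let (ξ_k)_{k∈ℕ}, ξ_k : {1,…,n−1} → ℝ with ξ_0(u) ≥ 0 for all u, evolve by the linear rule ξ_{k+1}(v_k) = (1−2μ)ξ_k(v_k), ξ_{k+1}(u) = ξ_k(u) + μ ξ_k(v_k) for u ∈ {v_k−1, v_k+1} ∩ {1,…,n−1}, and ξ_{k+1}(u) = ξ_k(u) for all other u. Then ξ_k(u) → 0 as k → ∞ for every u ∈ {1,…,n−1}. -/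
open Filter Topology
open scoped BigOperators

noncomputable section

/-- The linear (unwrapped) edge-difference update of the compass model on the path
`P_n`: an update at edge `e_v` multiplies the value at `e_v` by `1 - 2μ` and adds `μ`
times the old value at `e_v` to the values at the neighboring edges
`e_{v-1}, e_{v+1}` (where these exist, i.e. within `{1, …, n-1}`). -/
def linUpdate (μ : ℝ) (n v : ℕ) (ξ : ℕ → ℝ) : ℕ → ℝ := fun u =>
  if u = v then (1 - 2*μ) * ξ v
  else if (u + 1 = v ∨ u = v + 1) ∧ 1 ≤ u ∧ u ≤ n - 1 then ξ u + μ * ξ v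
  else ξ u

/-- On the edges of the path, `linUpdate` adds `μ * ξ v` times the discrete Laplacian of the
indicator of `v`. -/
theorem linUpdate_eq_add {μ : ℝ} {n v u : ℕ} (ξ : ℕ → ℝ) (hu : u ∈ Finset.Icc 1 (n - 1)) :
    linUpdate μ n v ξ u = ξ u + μ * ξ v *
      ((if u + 1 = v then 1 else 0) + (if u = v + 1 then 1 else 0)
        - 2 * (if u = v then 1 else 0)) := by
  rw [Finset.mem_Icc] at hu
  unfold linUpdate
  by_cases h : u = v
  · subst h
    simp
    ring
  by_cases h1 : u + 1 = v
  · have h2 : u ≠ v + 1 := by omega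
    simp [h, h1, h2, hu]
  by_cases h2 : u = v + 1
  · simp [h2, show v + 1 ≤ n - 1 by omega, show v + 1 + 1 ≠ v by omega]
  · simp [h, h1, h2]

/-- The strictly concave weight `u * (n - u)` makes the weighted total decrease by exactly
`2 * μ * ξ v` under an update at `v`. -/
theorem sum_weight_mul_linUpdate {μ : ℝ} {n v : ℕ} (ξ : ℕ → ℝ) (hv : v ∈ Finset.Icc 1 (n - 1)) :
    ∑ u ∈ Finset.Icc 1 (n - 1), (u : ℝ) * (n - u) * linUpdate μ n v ξ u =
      ∑ u ∈ Finset.Icc 1 (n - 1), (u : ℝ) * (n - u) * ξ u - 2 * μ * ξ v := by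
  have hleft : ∑ u ∈ Finset.Icc 1 (n - 1), (u : ℝ) * (n - u) * (if u + 1 = v then 1 else 0) =
      (v - 1) * (n - (v - 1)) := by
    rw [Finset.mem_Icc] at hv
    obtain ⟨w, rfl⟩ : ∃ w, v = w + 1 := ⟨v - 1, by omega⟩
    simp only [add_left_inj, mul_ite, mul_one, mul_zero, Finset.sum_ite_eq', Finset.mem_Icc]
    split_ifs with h
    · push_cast; ring
    · obtain rfl : w = 0 := by omega
      simp
  have hright : ∑ u ∈ Finset.Icc 1 (n - 1), (u : ℝ) * (n - u) * (if u = v + 1 then 1 else 0) =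
      (v + 1) * (n - (v + 1)) := by
    rw [Finset.mem_Icc] at hv
    simp only [mul_ite, mul_one, mul_zero, Finset.sum_ite_eq', Finset.mem_Icc]
    split_ifs with h
    · push_cast; ring
    · obtain rfl : n = v + 1 := by omega
      simp
  have hmid : ∑ u ∈ Finset.Icc 1 (n - 1), (u : ℝ) * (n - u) * (if u = v then 1 else 0) =
      v * (n - v) := by
    simp only [mul_ite, mul_one, mul_zero, Finset.sum_ite_eq', if_pos hv]
  calc
    _ = ∑ u ∈ Finset.Icc 1 (n - 1), ((u : ℝ) * (n - u) * ξ u + μ * ξ v *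
          ((u : ℝ) * (n - u) * (if u + 1 = v then 1 else 0)
            + (u : ℝ) * (n - u) * (if u = v + 1 then 1 else 0)
            - 2 * ((u : ℝ) * (n - u) * (if u = v then 1 else 0)))) := by
      refine Finset.sum_congr rfl fun u hu => ?_
      rw [linUpdate_eq_add ξ hu]
      ring
    _ = _ := by
      rw [Finset.sum_add_distrib, ← Finset.mul_sum, Finset.sum_sub_distrib,
        Finset.sum_add_distrib, ← Finset.mul_sum, hleft, hright, hmid]
      ring

theorem le_linUpdate_of_ne {μ : ℝ} (hμ : 0 ≤ μ) {n v u : ℕ} {ξ : ℕ → ℝ} (hv : 0 ≤ ξ v)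
    (h : u ≠ v) : ξ u ≤ linUpdate μ n v ξ u := by
  have := mul_nonneg hμ hv
  unfold linUpdate
  rw [if_neg h]
  split_ifs <;> linarith

theorem linUpdate_nonneg {μ : ℝ} (hμ : μ ∈ Set.Ioc (0 : ℝ) (1 / 2)) {n v u : ℕ} {ξ : ℕ → ℝ}
    (hv : 0 ≤ ξ v) (hu : 0 ≤ ξ u) : 0 ≤ linUpdate μ n v ξ u := by
  by_cases h : u = v
  · simp only [linUpdate, if_pos h]
    exact mul_nonneg (by linarith [hμ.2]) hv
  · exact hu.trans (le_linUpdate_of_ne hμ.1.le hv h)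

/-- Convergence of the unwrapped edge-difference process on the path `P_n`: if every
edge index in `{1, …, n-1}` occurs infinitely often in the update sequence and the
initial values are nonnegative, then all edge values tend to `0`. -/
theorem unwrapped_process_tendsto_zero (μ : ℝ) (hμ : μ ∈ Set.Ioc (0:ℝ) (1/2)) (n : ℕ)
    (hn : 2 ≤ n) (v : ℕ → ℕ) (hvmem : ∀ k, v k ∈ Finset.Icc 1 (n-1))
    (hio : ∀ w ∈ Finset.Icc 1 (n-1), ∀ K : ℕ, ∃ k, K ≤ k ∧ v k = w)
    (ξ : ℕ → ℕ → ℝ) (h0 : ∀ u ∈ Finset.Icc 1 (n-1), 0 ≤ ξ 0 u)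
    (hξ : ∀ k, ξ (k+1) = linUpdate μ n (v k) (ξ k)) :
    ∀ u ∈ Finset.Icc 1 (n-1), Tendsto (fun k => ξ k u) atTop (𝓝 0) := by
  have hnn : ∀ k, ∀ u ∈ Finset.Icc 1 (n - 1), 0 ≤ ξ k u := by
    intro k
    induction k with
    | zero => exact h0
    | succ k ih =>
      intro u hu
      rw [hξ]
      exact linUpdate_nonneg hμ (ih _ (hvmem k)) (ih u hu)
  have ha : ∀ k, 0 ≤ ξ k (v k) := fun k => hnn k _ (hvmem k)
  set Φ : ℕ → ℝ := fun k => ∑ u ∈ Finset.Icc 1 (n - 1), (u : ℝ) * (n - u) * ξ k u with hΦ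
  have hΦ_nonneg : ∀ k, 0 ≤ Φ k := by
    refine fun k => Finset.sum_nonneg fun u hu => mul_nonneg ?_ (hnn k u hu)
    have hun : u ≤ n := by
      rw [Finset.mem_Icc] at hu
      omega
    exact mul_nonneg u.cast_nonneg (sub_nonneg.2 (Nat.cast_le.2 hun))
  have hΦ_sum : ∀ k, Φ k + 2 * μ * ∑ j ∈ Finset.range k, ξ j (v j) = Φ 0 := by
    intro k
    induction k with
    | zero => simp
    | succ k ih =>
      have hstep : Φ (k + 1) = Φ k - 2 * μ * ξ k (v k) := by
        simp only [hΦ, hξ k]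
        exact sum_weight_mul_linUpdate (ξ k) (hvmem k)
      rw [Finset.sum_range_succ, hstep, ← ih]
      ring
  have hsummable : Summable fun k => ξ k (v k) := by
    refine summable_of_sum_range_le (c := Φ 0 / (2 * μ)) ha fun k => ?_
    rw [le_div_iff₀ (by linarith [hμ.1])]
    linarith [hΦ_sum k, hΦ_nonneg k]
  intro u hu
  have hle_next : ∀ d k, v (k + d) = u → ∃ j, k ≤ j ∧ ξ k u ≤ ξ j (v j) := by
    intro d
    induction d with
    | zero =>
      rintro k rfl
      exact ⟨k, le_rfl, le_rfl⟩
    | succ d ih =>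
      intro k hk
      by_cases h : u = v k
      · exact ⟨k, le_rfl, h ▸ le_rfl⟩
      · obtain ⟨j, hj, hle⟩ := ih (k + 1) (by rw [← hk]; congr 1; ring)
        refine ⟨j, by omega, le_trans ?_ hle⟩
        rw [hξ]
        exact le_linUpdate_of_ne hμ.1.le (ha k) h
  rw [Metric.tendsto_atTop]
  intro ε hε
  obtain ⟨K, hK⟩ := Metric.tendsto_atTop.1 hsummable.tendsto_atTop_zero ε hε
  refine ⟨K, fun k hk => ?_⟩
  obtain ⟨k', hkk', hvk'⟩ := hio u hu k
  obtain ⟨j, hj, hle⟩ := hle_next (k' - k) k (by rwa [Nat.add_sub_cancel' hkk'])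
  have hKj := hK j (hk.trans hj)
  rw [Real.dist_0_eq_abs, abs_of_nonneg (ha j)] at hKj
  rw [Real.dist_0_eq_abs, abs_of_nonneg (hnn k u hu)]
  exact hle.trans_lt hKj
end
end

section
/- (Equality in the circle triangle inequality forces equal signs.) Let μ ∈ (0,1/2] and let α, β ∈ (−1,1] ⊂ ℝ. Write ‖·‖ for the quotient norm on S = ℝ/2ℤ, so that ‖[α]‖ = |α| and ‖[β]‖ = |β| and always ‖[α + μβ]‖ ≤ |α| + μ|β|. If equality holds, i.e. ‖[α + μβ]‖ = |α| + μ|β|, then α·β ≥ 0. (This is the pointwise criterion underlying the paper's Lemma 6.1: a.s. equality of ‖Δ_0(e_0) + μ Δ_0(e_{−1})‖ and ‖Δ_0(e_0)‖ + μ‖Δ_0(e_{−1})‖ forces neighboring edge differences to have the same sign.) -/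
noncomputable section

/-- Equality in the circle triangle inequality forces equal signs: for edge differences
`α, β ∈ (-1, 1]`, if `‖[α + μβ]‖ = |α| + μ|β|` in `S = ℝ/2ℤ`, then `α·β ≥ 0`. -/
theorem norm_eq_add_imp_same_sign (μ α β : ℝ) (hμ : μ ∈ Set.Ioc (0:ℝ) (1/2))
    (hα : α ∈ Set.Ioc (-1:ℝ) 1) (hβ : β ∈ Set.Ioc (-1:ℝ) 1)
    (h : ‖((α + μ * β : ℝ) : S)‖ = |α| + μ * |β|) :
    0 ≤ α * β := by
  by_contra! hneg
  have hle : ‖((α + μ * β : ℝ) : S)‖ ≤ |α + μ * β| := QuotientAddGroup.norm_mk_le_norm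
  have hμ0 : 0 < μ := hμ.1
  rw [h] at hle
  rcases mul_neg_iff.mp hneg with ⟨ha, hb⟩ | ⟨ha, hb⟩
  · rw [abs_of_pos ha, abs_of_neg hb] at hle
    have := mul_neg_of_pos_of_neg hμ0 hb
    rcases abs_cases (α + μ * β) with hc | hc <;> linarith
  · rw [abs_of_neg ha, abs_of_pos hb] at hle
    have := mul_pos hμ0 hb
    rcases abs_cases (α + μ * β) with hc | hc <;> linarith
end
end

section
/- (Noise sensitivity of the compass model on finite paths.) For every μ ∈ (0,1/2] there exist n ≥ 2, two initial configurations η_0, η'_0 : {1,…,n} → S that differ at exactly one vertex, a sequence of edge indices (v_k)_{k∈ℕ} in {1,…,n−1} in which every index occurs infinitely often, and two runs (η_k)_{k∈ℕ} and (η'_k)_{k∈ℕ} where for each k the configurations η_{k+1} and η'_{k+1} are obtained from η_k and η'_k respectively by μ-compromises at the same edge e_{v_k}, such that the common limits L = lim_{k→∞} η_k(v) and L' = lim_{k→∞} η'_k(v) (which exist and are independent of v) satisfy ‖L − L'‖ = 1, the maximal possible distance on S. (In contrast, in the trivial Deffuant model on P_n, altering one initial opinion changes the common limit by at most 1/n.)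 -/
open Filter Topology MeasureTheory
open scoped BigOperators

noncomputable section

/-- Real lifts of the opinions on `P_3` under updates alternating between the two edges.
After each update the path is reflected, so that the next updated edge always consists of
the second and third coordinates. -/
def reflectedOrbit (μ : ℝ) : ℕ → ℝ × ℝ × ℝ
  | 0 => (0, 1 / 2, -1 / 2)
  | k + 1 =>
    let y := reflectedOrbit μ k
    (y.2.2 + μ * (y.2.1 - y.2.2), y.2.1 + μ * (y.2.2 - y.2.1), y.1)

/-- The lifted opinions on `P_3`, obtained from `reflectedOrbit` by undoing the reflections. -/
def liftedRun (μ : ℝ) (k u : ℕ) : ℝ :=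
  if u = 2 then (reflectedOrbit μ k).2.1
  else if u = 1 then
    if k % 2 = 0 then (reflectedOrbit μ k).1 else (reflectedOrbit μ k).2.2
  else if u = 3 then
    if k % 2 = 0 then (reflectedOrbit μ k).2.2 else (reflectedOrbit μ k).1
  else 0

/-- The alternating edge sequence `2, 1, 2, 1, …`. -/
def alternatingEdge (k : ℕ) : ℕ := if k % 2 = 0 then 2 else 1

lemma reflectedOrbit_abs_le {μ : ℝ} (h0 : 0 < μ) (h1 : μ ≤ 1 / 2) (k : ℕ) :
    |(reflectedOrbit μ k).1| ≤ 1 / 2 ∧ |(reflectedOrbit μ k).2.1| ≤ 1 / 2 ∧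
      |(reflectedOrbit μ k).2.2| ≤ 1 / 2 := by
  induction k with
  | zero => norm_num [reflectedOrbit, abs_le]
  | succ k ih =>
    obtain ⟨hA, hB, hC⟩ := ih
    simp only [reflectedOrbit]
    rw [abs_le] at hB hC
    refine ⟨abs_le.2 ⟨?_, ?_⟩, abs_le.2 ⟨?_, ?_⟩, hA⟩ <;> nlinarith

lemma reflectedOrbit_sum (μ : ℝ) (k : ℕ) :
    (reflectedOrbit μ k).1 + (reflectedOrbit μ k).2.1 + (reflectedOrbit μ k).2.2 = 0 := by
  induction k with
  | zero => norm_num [reflectedOrbit]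
  | succ k ih => simp only [reflectedOrbit]; linarith

/-- A weighted `ℓ¹` norm of the edge differences contracts by `1 - μ ^ 2` at every update. -/
lemma reflectedOrbit_diff_le {μ : ℝ} (h0 : 0 < μ) (h1 : μ ≤ 1 / 2) (k : ℕ) :
    (1 + μ) * |(reflectedOrbit μ k).2.1 - (reflectedOrbit μ k).1| +
      |(reflectedOrbit μ k).2.2 - (reflectedOrbit μ k).2.1| ≤ 2 * (1 - μ ^ 2) ^ k := by
  induction k with
  | zero => norm_num [reflectedOrbit, abs_of_pos]; linarith
  | succ k ih =>
    simp only [reflectedOrbit]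
    generalize (reflectedOrbit μ k).1 = A at *
    generalize (reflectedOrbit μ k).2.1 = B at *
    generalize (reflectedOrbit μ k).2.2 = C at *
    have e1 : |B + μ * (C - B) - (C + μ * (B - C))| = (1 - 2 * μ) * |C - B| := by
      rw [show B + μ * (C - B) - (C + μ * (B - C)) = -((1 - 2 * μ) * (C - B)) by ring,
        abs_neg, abs_mul, abs_of_nonneg (by linarith : 0 ≤ 1 - 2 * μ)]
    have e2 : |A - (B + μ * (C - B))| ≤ |B - A| + μ * |C - B| := by
      rw [show A - (B + μ * (C - B)) = -((B - A) + μ * (C - B)) by ring, abs_neg]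
      refine (abs_add_le _ _).trans ?_
      rw [abs_mul, abs_of_pos h0]
    rw [e1, pow_succ]
    have hs := abs_nonneg (B - A)
    have hr := abs_nonneg (C - B)
    have hρ : 0 ≤ 1 - μ ^ 2 := by nlinarith
    have key : (1 + μ) * ((1 - 2 * μ) * |C - B|) + (|B - A| + μ * |C - B|) ≤
        ((1 + μ) * |B - A| + |C - B|) * (1 - μ ^ 2) := by
      have c1 : 0 ≤ (1 + μ) * (1 - μ ^ 2) - 1 := by
        have : 0 ≤ 1 - μ - μ ^ 2 := by nlinarith
        nlinarith [mul_nonneg h0.le this]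
      have c2 := mul_nonneg c1 hs
      have c3 := mul_nonneg (sq_nonneg μ) hr
      nlinarith
    have := mul_le_mul_of_nonneg_right ih hρ
    linarith

lemma liftedRun_tendsto {μ : ℝ} (h0 : 0 < μ) (h1 : μ ≤ 1 / 2) (u : ℕ) :
    Tendsto (fun k => liftedRun μ k u) atTop (𝓝 0) := by
  have hlim : Tendsto (fun k : ℕ => 2 * (1 - μ ^ 2) ^ k) atTop (𝓝 0) := by
    simpa using (tendsto_pow_atTop_nhds_zero_of_lt_one
      (by nlinarith : 0 ≤ 1 - μ ^ 2) (by nlinarith)).const_mul 2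
  refine squeeze_zero_norm (fun k => ?_) hlim
  have hN := reflectedOrbit_diff_le h0 h1 k
  have hS := reflectedOrbit_sum μ k
  have hp : 0 ≤ 2 * (1 - μ ^ 2) ^ k := by
    have : 0 ≤ 1 - μ ^ 2 := by nlinarith
    positivity
  rw [Real.norm_eq_abs]
  unfold liftedRun
  generalize (reflectedOrbit μ k).1 = A at *
  generalize (reflectedOrbit μ k).2.1 = B at *
  generalize (reflectedOrbit μ k).2.2 = C at *
  have hN' : |B - A| + |C - B| ≤ 2 * (1 - μ ^ 2) ^ k := by
    nlinarith [abs_nonneg (B - A)]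
  have := neg_abs_le (B - A)
  have := le_abs_self (B - A)
  have := neg_abs_le (C - B)
  have := le_abs_self (C - B)
  split_ifs <;> rw [abs_le] <;> constructor <;> linarith

lemma liftedRun_update (μ : ℝ) (k : ℕ) :
    liftedRun μ (k + 1) (alternatingEdge k) =
        liftedRun μ k (alternatingEdge k) +
          μ * (liftedRun μ k (alternatingEdge k + 1) - liftedRun μ k (alternatingEdge k)) ∧
      liftedRun μ (k + 1) (alternatingEdge k + 1) =
        liftedRun μ k (alternatingEdge k + 1) +
          μ * (liftedRun μ k (alternatingEdge k) - liftedRun μ k (alternatingEdge k + 1)) ∧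
      ∀ u, u ≠ alternatingEdge k → u ≠ alternatingEdge k + 1 →
        liftedRun μ (k + 1) u = liftedRun μ k u := by
  rcases Nat.mod_two_eq_zero_or_one k with h | h
  · have h' : (k + 1) % 2 = 1 := by omega
    refine ⟨?_, ?_, fun u hu hu' => ?_⟩ <;>
      simp_all [liftedRun, alternatingEdge, reflectedOrbit]
  · have h' : (k + 1) % 2 = 0 := by omega
    refine ⟨?_, ?_, fun u hu hu' => ?_⟩ <;>
      simp_all [liftedRun, alternatingEdge, reflectedOrbit]

lemma liftedRun_abs_le {μ : ℝ} (h0 : 0 < μ) (h1 : μ ≤ 1 / 2) (k u : ℕ) :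
    |liftedRun μ k u| ≤ 1 / 2 := by
  obtain ⟨hA, hB, hC⟩ := reflectedOrbit_abs_le h0 h1 k
  unfold liftedRun
  split_ifs <;> first | assumption | norm_num

lemma liftedRun_abs_sub_le {μ : ℝ} (h0 : 0 < μ) (h1 : μ ≤ 1 / 2) (k u w : ℕ) :
    |liftedRun μ k u - liftedRun μ k w| ≤ 1 := by
  have := abs_sub (liftedRun μ k u) (liftedRun μ k w)
  linarith [liftedRun_abs_le h0 h1 k u, liftedRun_abs_le h0 h1 k w]

lemma alternatingEdge_bounds (k : ℕ) : 1 ≤ alternatingEdge k ∧ alternatingEdge k + 1 ≤ 3 := by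
  unfold alternatingEdge
  split_ifs <;> simp

lemma norm_coe_one : ‖((1 : ℝ) : S)‖ = 1 := by
  have := AddCircle.norm_half_period_eq (p := (2 : ℝ))
  norm_num at this
  simpa using this

/-- Noise sensitivity of the compass model on finite paths: for every `μ ∈ (0, 1/2]`
there are a path `P_n`, two initial configurations differing at exactly one vertex, and
a common update sequence (hitting every edge infinitely often) such that the two runs
converge to common limits `L, L'` at maximal distance `‖L - L'‖ = 1`. -/
theorem compass_noise_sensitive :
    ∀ μ ∈ Set.Ioc (0:ℝ) (1/2),
      ∃ (n : ℕ) (_ : 2 ≤ n) (η η' : ℕ → ℕ → S) (v : ℕ → ℕ) (w : ℕ) (L L' : S),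
        w ∈ Finset.Icc 1 n ∧
        η 0 w ≠ η' 0 w ∧
        (∀ u ∈ Finset.Icc 1 n, u ≠ w → η 0 u = η' 0 u) ∧
        (∀ e ∈ Finset.Icc 1 (n-1), ∀ K : ℕ, ∃ k, K ≤ k ∧ v k = e) ∧
        (∀ k, UpdateAt μ n (v k) (η k) (η (k+1))) ∧
        (∀ k, UpdateAt μ n (v k) (η' k) (η' (k+1))) ∧
        (∀ u ∈ Finset.Icc 1 n, Tendsto (fun k => η k u) atTop (𝓝 L)) ∧
        (∀ u ∈ Finset.Icc 1 n, Tendsto (fun k => η' k u) atTop (𝓝 L')) ∧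
        ‖L - L'‖ = 1 := by
  rintro μ ⟨h0, h1⟩
  have hcont : Continuous (fun x : ℝ => (x : S)) := AddCircle.continuous_mk' 2
  refine ⟨3, by norm_num, fun k u => (liftedRun μ k u : S),
    fun k u => ((1 - liftedRun μ k u : ℝ) : S), alternatingEdge, 1, ((0 : ℝ) : S),
    ((1 : ℝ) : S), by simp, ?_, ?_, ?_, fun k => ?_, fun k => ?_, fun u _ => ?_,
    fun u _ => ?_, ?_⟩
  · intro h
    have h' : ((0 : ℝ) : S) = ((1 : ℝ) : S) := by simpa [liftedRun, reflectedOrbit] using h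
    have hn := norm_coe_one
    rw [← h'] at hn
    simp at hn
  · intro u hu hu1
    obtain rfl | rfl : u = 2 ∨ u = 3 := by
      rw [Finset.mem_Icc] at hu
      omega
    · norm_num [liftedRun, reflectedOrbit]
    · simp only [liftedRun, reflectedOrbit]
      norm_num only [if_true, if_false]
      rw [← sub_eq_zero, ← AddCircle.coe_sub, AddCircle.coe_eq_zero_iff]
      exact ⟨-1, by norm_num⟩
  · intro e he K
    obtain rfl | rfl : e = 1 ∨ e = 2 := by
      rw [Finset.mem_Icc] at he
      omega
    · exact ⟨2 * K + 1, by omega, by simp [alternatingEdge, Nat.add_mod]⟩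
    · exact ⟨2 * K, by omega, by simp [alternatingEdge]⟩
  · obtain ⟨hv, hv', hu⟩ := liftedRun_update μ k
    exact ⟨(alternatingEdge_bounds k).1, (alternatingEdge_bounds k).2,
      ⟨_, _, rfl, rfl, liftedRun_abs_sub_le h0 h1 k _ _, congrArg _ hv, congrArg _ hv'⟩,
      fun u h h' => congrArg _ (hu u h h')⟩
  · obtain ⟨hv, hv', hu⟩ := liftedRun_update μ k
    refine ⟨(alternatingEdge_bounds k).1, (alternatingEdge_bounds k).2,
      ⟨_, _, rfl, rfl, ?_, ?_, ?_⟩, fun u h h' => ?_⟩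
    · rw [sub_sub_sub_cancel_left]
      exact liftedRun_abs_sub_le h0 h1 k _ _
    · exact congrArg (fun x : ℝ => (x : S)) (by rw [hv]; ring)
    · exact congrArg (fun x : ℝ => (x : S)) (by rw [hv']; ring)
    · exact congrArg (fun x : ℝ => ((1 - x : ℝ) : S)) (hu u h h')
  · exact (hcont.tendsto 0).comp (liftedRun_tendsto h0 h1 u)
  · have h := (liftedRun_tendsto h0 h1 u).const_sub 1
    rw [sub_zero] at h
    exact (hcont.tendsto 1).comp h
  · rw [← AddCircle.coe_sub, zero_sub, AddCircle.coe_neg, norm_neg]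
    exact norm_coe_one
end
end
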